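/- arXiv:math/0606242 — 9 statements merged into one kernel-verified Lean document; each statement's English description precedes it below -/
import Mathlib

section
/- Let n be a positive integer, let R be a set of rational numbers contained in [0,1] such that n·r is an integer for every r ∈ R, and let ε be a real number with 0 ≤ ε ≤ 1/(n+1). Then Φ(R, ε) ⊆ 𝒫_n; that is, every α ∈ Φ(R, ε) satisfies 0 ≤ α ≤ 1 and ⌊(n+1)·α⌋ ≥ n·α. -/
/-- Hyperstandard multiplicities `Φ(R)` associated with a set `R ⊆ ℝ`. -/
def Phi (R : Set ℝ) : Set ℝ :=
  {x | x ∈ Set.Icc (0:ℝ) 1 ∧ ∃ r ∈ R, ∃ m : ℕ, 0 < m ∧ x = 1 - r / m}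

/-- Semi-hyperstandard multiplicities `Φ(R, ε) = Φ(R) ∪ [1-ε, 1]`. -/
def PhiEps (R : Set ℝ) (ε : ℝ) : Set ℝ :=
  Phi R ∪ Set.Icc (1 - ε) 1

/-- The set `𝒫_n = {α ∈ [0,1] : ⌊(n+1)α⌋ ≥ nα}`. -/
def Pset (n : ℕ) : Set ℝ :=
  {α | 0 ≤ α ∧ α ≤ 1 ∧ (n : ℝ) * α ≤ (⌊((n : ℝ) + 1) * α⌋ : ℝ)}

theorem stmt_0 (n : ℕ) (hn : 0 < n) (R : Set ℝ) (hR : R ⊆ Set.Icc (0:ℝ) 1)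
    (hint : ∀ r ∈ R, ∃ k : ℤ, (n : ℝ) * r = (k : ℝ))
    (ε : ℝ) (hε0 : 0 ≤ ε) (hε1 : ε ≤ 1 / ((n : ℝ) + 1)) :
    PhiEps R ε ⊆ Pset n := by
  rintro α (⟨⟨h0, h1⟩, r, hr, m, hm, rfl⟩ | ⟨h0, h1⟩)
  · refine ⟨h0, h1, ?_⟩
    obtain ⟨k, hk⟩ := hint r hr
    have hr1 : r ≤ 1 := (hR hr).2
    have hmR : (0 : ℝ) < m := by exact_mod_cast hm
    have hmZ : (0 : ℤ) < m := by exact_mod_cast hm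
    have hlo : ((k / m : ℤ) : ℝ) * m ≤ k := by
      exact_mod_cast Int.ediv_mul_le k hmZ.ne'
    have hhi : (k : ℝ) + 1 ≤ (((k / m : ℤ) : ℝ) + 1) * m := by
      exact_mod_cast Int.lt_ediv_add_one_mul_self k hmZ
    have hfloor : (n : ℤ) - k / m ≤ ⌊((n : ℝ) + 1) * (1 - r / m)⌋ := by
      rw [Int.le_floor, Int.cast_sub, Int.cast_natCast]
      have h : (k + r) / m ≤ ((k / m : ℤ) : ℝ) + 1 := by
        rw [div_le_iff₀ hmR]
        linarith
      have e : ((n : ℝ) + 1) * (1 - r / m) = n + 1 - (k + r) / m := by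
        rw [← hk]
        ring
      linarith
    have hupper : (n : ℝ) * (1 - r / m) ≤ n - ((k / m : ℤ) : ℝ) := by
      have h : ((k / m : ℤ) : ℝ) ≤ k / m := by rwa [le_div_iff₀ hmR]
      have e : (n : ℝ) * (1 - r / m) = n - k / m := by
        rw [← hk]
        ring
      linarith
    exact hupper.trans (by exact_mod_cast hfloor)
  · have hn0 : (0 : ℝ) < (n : ℝ) + 1 := by positivity
    have hε : ε * ((n : ℝ) + 1) ≤ 1 := by rwa [le_div_iff₀ hn0] at hε1
    have hε_le_one : ε ≤ 1 := by nlinarith [mul_nonneg hε0 (Nat.cast_nonneg (α := ℝ) n)]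
    refine ⟨by linarith, h1, ?_⟩
    have hfloor : (n : ℤ) ≤ ⌊((n : ℝ) + 1) * α⌋ := by
      rw [Int.le_floor, Int.cast_natCast]
      nlinarith
    exact (mul_le_of_le_one_right n.cast_nonneg h1).trans (by exact_mod_cast hfloor)
end

section
/- Let R be a finite set of rational numbers with R ⊆ [0,1]. Then R̄ is a finite set of rational numbers. -/
/-- The set `R̄` obtained from `R ⊆ ℝ`: nonnegative numbers of the form
`r₀ - m·∑_{i=1}^{s}(1 - r_i)` with `r₀, r₁, …, r_s ∈ R` and `m` a positive integer. -/
def Rbar (R : Set ℝ) : Set ℝ :=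
  {x | 0 ≤ x ∧ ∃ s : ℕ, ∃ r₀ ∈ R, ∃ r : Fin s → ℝ, (∀ i, r i ∈ R) ∧
    ∃ m : ℕ, 0 < m ∧ x = r₀ - (m : ℝ) * ∑ i, (1 - r i)}

/-- A finite set of rational real numbers has a common denominator. -/
theorem Set.Finite.exists_common_denominator {R : Set ℝ} (hfin : R.Finite)
    (hrat : ∀ x ∈ R, ∃ q : ℚ, x = (q : ℝ)) :
    ∃ N : ℕ, 0 < N ∧ ∀ x ∈ R, ∃ k : ℤ, (N : ℝ) * x = k := by
  induction R, hfin using Set.Finite.induction_on with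
  | empty => exact ⟨1, one_pos, by simp⟩
  | @insert a s _ _ ih =>
    obtain ⟨N, hN, h⟩ := ih fun x hx => hrat x (Set.mem_insert_of_mem a hx)
    obtain ⟨q, hq⟩ := hrat a (Set.mem_insert a s)
    refine ⟨N * q.den, Nat.mul_pos hN q.den_pos, ?_⟩
    rintro x (rfl | hx)
    · refine ⟨N * q.num, ?_⟩
      have hden : (q.den : ℝ) * q = q.num := by exact_mod_cast Rat.den_mul_eq_num q
      push_cast
      rw [hq, mul_assoc, hden]
    · obtain ⟨k, hk⟩ := h x hx
      refine ⟨q.den * k, ?_⟩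
      push_cast
      rw [← hk]
      ring

theorem stmt_6 (R : Set ℝ) (hfin : R.Finite) (hsub : R ⊆ Set.Icc (0:ℝ) 1)
    (hrat : ∀ x ∈ R, ∃ q : ℚ, x = (q : ℝ)) :
    (Rbar R).Finite ∧ ∀ x ∈ Rbar R, ∃ q : ℚ, x = (q : ℝ) := by
  obtain ⟨N, hN, hden⟩ := hfin.exists_common_denominator hrat
  have hN' : (0 : ℝ) < N := by exact_mod_cast hN
  have key : ∀ x ∈ Rbar R, ∃ k ∈ Set.Icc (0 : ℤ) N, (k : ℝ) / N = x := by
    rintro x ⟨hx, s, r₀, hr₀, r, hr, m, -, hxeq⟩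
    obtain ⟨k₀, hk₀⟩ := hden r₀ hr₀
    choose k hk using fun i => hden (r i) (hr i)
    have hNx : (N : ℝ) * x = ((k₀ - m * ∑ i, (N - k i) : ℤ) : ℝ) := by
      push_cast
      simp only [← hk, ← hk₀, hxeq, ← mul_one_sub, ← Finset.mul_sum]
      ring
    have hsum : 0 ≤ (m : ℝ) * ∑ i, (1 - r i) :=
      mul_nonneg m.cast_nonneg (Finset.sum_nonneg fun i _ => sub_nonneg.2 (hsub (hr i)).2)
    have hx1 : x ≤ 1 := by linarith [(hsub hr₀).2]
    refine ⟨_, ⟨?_, ?_⟩, (eq_div_of_mul_eq hN'.ne' (by rw [mul_comm, hNx])).symm⟩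
    · exact_mod_cast hNx ▸ mul_nonneg hN'.le hx
    · exact_mod_cast hNx ▸ mul_le_of_le_one_right hN'.le hx1
  refine ⟨((Set.finite_Icc (0 : ℤ) N).image fun k : ℤ => (k : ℝ) / N).subset key, fun x hx => ?_⟩
  obtain ⟨k, -, rfl⟩ := key x hx
  exact ⟨k / N, by push_cast; rfl⟩
end

section
/- Let R be a finite set of rational numbers with R ⊆ [0,1]. Then the least common multiple of the denominators (in lowest terms) of the elements of R̄ equals the least common multiple of the denominators of the elements of R; in particular, I(R) = I(R̄). -/
/-- The set `R̄` for a set `R` of rational numbers: nonnegative numbers of the form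
`r₀ - m·∑_{i=1}^{s}(1 - r_i)` with `r₀, r₁, …, r_s ∈ R` and `m` a positive integer. -/
def RbarQ (R : Set ℚ) : Set ℚ :=
  {x | 0 ≤ x ∧ ∃ s : ℕ, ∃ r₀ ∈ R, ∃ r : Fin s → ℚ, (∀ i, r i ∈ R) ∧
    ∃ m : ℕ, 0 < m ∧ x = r₀ - (m : ℚ) * ∑ i, (1 - r i)}

theorem Rat.den_sub_dvd_of_dvd {a b : ℚ} {N : ℕ} (ha : a.den ∣ N) (hb : b.den ∣ N) :
    (a - b).den ∣ N := by
  rw [sub_eq_add_neg]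
  exact (Rat.add_den_dvd_lcm a (-b)).trans (Nat.lcm_dvd ha (by simpa using hb))

theorem Rat.den_natCast_mul_dvd_of_dvd (m : ℕ) {a : ℚ} {N : ℕ} (ha : a.den ∣ N) :
    ((m : ℚ) * a).den ∣ N :=
  (Rat.mul_den_dvd m a).trans (by simpa using ha)

theorem Rat.den_sum_dvd_of_dvd {ι : Type*} (t : Finset ι) {f : ι → ℚ} {N : ℕ}
    (hf : ∀ i ∈ t, (f i).den ∣ N) : (∑ i ∈ t, f i).den ∣ N :=
  Finset.sum_induction f (fun q => q.den ∣ N)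
    (fun a b ha hb => (Rat.add_den_dvd_lcm a b).trans (Nat.lcm_dvd ha hb)) (by simp) hf

theorem den_dvd_of_mem_RbarQ {R : Set ℚ} {N : ℕ} (hN : ∀ q ∈ R, q.den ∣ N) {x : ℚ}
    (hx : x ∈ RbarQ R) : x.den ∣ N := by
  obtain ⟨-, s, r₀, hr₀, r, hr, m, -, rfl⟩ := hx
  exact Rat.den_sub_dvd_of_dvd (hN r₀ hr₀) <| Rat.den_natCast_mul_dvd_of_dvd m <|
    Rat.den_sum_dvd_of_dvd _ fun i _ => Rat.den_sub_dvd_of_dvd (by simp) (hN _ (hr i))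

theorem mem_RbarQ_of_mem {R : Set ℚ} {q : ℚ} (hq : q ∈ R) (h0 : 0 ≤ q) : q ∈ RbarQ R :=
  ⟨h0, 0, q, hq, Fin.elim0, fun i => i.elim0, 1, one_pos, by simp⟩

theorem stmt_7 (R : Finset ℚ) (hR : ∀ q ∈ R, 0 ≤ q ∧ q ≤ 1)
    (hfin : (RbarQ (↑R : Set ℚ)).Finite) :
    hfin.toFinset.lcm (fun q => q.den) = R.lcm (fun q => q.den) := by
  apply Nat.dvd_antisymm
  · exact Finset.lcm_dvd fun x hx =>
      den_dvd_of_mem_RbarQ (fun _ hq => Finset.dvd_lcm hq) (hfin.mem_toFinset.1 hx)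
  · exact Finset.lcm_dvd fun q hq =>
      Finset.dvd_lcm (f := fun q : ℚ => q.den)
        (hfin.mem_toFinset.2 (mem_RbarQ_of_mem hq (hR q hq).1))
end

section
/- Let R ⊆ [0,1] be a set of real numbers satisfying the ascending chain condition. Then R̄ also satisfies the ascending chain condition. -/
/-- A set of reals satisfies the ascending chain condition if it contains no
strictly increasing infinite sequence. -/
def SatisfiesACC (S : Set ℝ) : Prop :=
  ∀ f : ℕ → ℝ, (∀ k, f k ∈ S) → ¬ StrictMono f

open Pointwise in
theorem satisfiesACC_iff_isPWO_neg (S : Set ℝ) : SatisfiesACC S ↔ (-S).IsPWO := by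
  rw [Set.isPWO_iff_isWF, Set.isWF_iff_no_descending_seq]
  constructor
  · intro h f hf hmem
    exact h (fun k => -f k) (fun k => hmem k) hf.neg
  · intro h f hmem hf
    exact h (fun k => -f k) hf.neg (fun k => by simpa using hmem k)

open Pointwise in
theorem SatisfiesACC.rbar {R : Set ℝ} (hsub : ∀ a ∈ R, a ≤ 1) (hacc : SatisfiesACC R) :
    SatisfiesACC (Rbar R) := by
  rw [satisfiesACC_iff_isPWO_neg] at hacc ⊢
  have hD : ({1} + -R : Set ℝ).IsPWO := (Set.isPWO_singleton 1).add hacc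
  have hmemD : ∀ a ∈ R, 1 - a ∈ ({1} + -R : Set ℝ) := fun a ha =>
    Set.mem_add.2 ⟨1, rfl, -a, by simpa using ha, by ring⟩
  have hnonneg : ∀ d ∈ ({1} + -R : Set ℝ), 0 ≤ d := by
    intro d hd
    obtain ⟨_, rfl, b, hb, rfl⟩ := Set.mem_add.1 hd
    linarith [hsub _ (Set.mem_neg.1 hb)]
  refine (hacc.add (hD.addSubmonoid_closure hnonneg)).mono ?_
  rintro x ⟨-, s, r₀, hr₀, r, hr, m, -, hx⟩
  refine Set.mem_add.2 ⟨-r₀, by simpa using hr₀, m • ∑ i, (1 - r i), ?_, ?_⟩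
  · exact nsmul_mem (sum_mem fun i _ => AddSubmonoid.subset_closure (hmemD _ (hr i))) m
  · rw [nsmul_eq_mul]
    linarith

theorem stmt_9 (R : Set ℝ) (hsub : R ⊆ Set.Icc (0:ℝ) 1)
    (hacc : SatisfiesACC R) : SatisfiesACC (Rbar R) :=
  hacc.rbar fun _ ha => (hsub ha).2
end

section
/- Let R ⊆ [0,1] be a set of real numbers with 1 ∈ R, let ε be a real number with 0 ≤ ε ≤ 1, let n be a positive integer, let s ≥ 0 be an integer, let b₀, …, b_s ∈ Φ(R, ε), and let k₀, …, k_s be nonnegative integers. Set d := 1 − 1/n + (∑_{i=0}^{s} k_i·b_i)/n. If d < 1, then d ∈ Φ(R̄, ε). (This is the multiplicity computation underlying the statement that divisorial adjunction takes boundaries with multiplicities in Φ(R, ε) to differents with multiplicities in Φ(R̄, ε).) -/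
/-- A nonnegative `r₀ - m·∑ kᵢ(1 - rᵢ)` with multiplicities `kᵢ` lies in `R̄`. -/
theorem mem_Rbar_of_multiplicities {ι : Type*} [Fintype ι] {R : Set ℝ} {r₀ : ℝ} (hr₀ : r₀ ∈ R)
    {m : ℕ} (hm : 0 < m) (k : ι → ℕ) (r : ι → ℝ) (hr : ∀ i, 0 < k i → r i ∈ R)
    (h : 0 ≤ r₀ - (m : ℝ) * ∑ i, (k i : ℝ) * (1 - r i)) :
    r₀ - (m : ℝ) * ∑ i, (k i : ℝ) * (1 - r i) ∈ Rbar R := by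
  let e := Fintype.equivFin (Σ i, Fin (k i))
  refine ⟨h, _, r₀, hr₀, fun j => r (e.symm j).1, fun j => ?_, m, hm, ?_⟩
  · exact hr _ (Fin.pos (e.symm j).2)
  · congr 2
    rw [e.symm.sum_comp (fun x => 1 - r x.1), Fintype.sum_sigma]
    simp [-Finset.sum_sub_distrib, mul_sub]

theorem nonneg_of_mem_PhiEps {R : Set ℝ} {ε x : ℝ} (hε : ε ≤ 1) (hx : x ∈ PhiEps R ε) :
    0 ≤ x := by
  rcases hx with hx | hx
  · exact hx.1.1
  · linarith [hx.1]

/-- A combination of elements of `Φ(R)` with total less than `1` has the form `1 - q / m` with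
`q ∈ R̄`. -/
theorem exists_mem_Rbar_one_sub_sum_eq_div {ι : Type*} [Fintype ι] {R : Set ℝ}
    (hsub : R ⊆ Set.Icc (0 : ℝ) 1) (h1 : (1 : ℝ) ∈ R) (b : ι → ℝ) (k : ι → ℕ)
    (hb0 : ∀ i, 0 ≤ b i) (hb : ∀ i, 0 < k i → b i ∈ Phi R)
    (hS : ∑ i, (k i : ℝ) * b i < 1) :
    ∃ q ∈ Rbar R, ∃ m : ℕ, 0 < m ∧ 1 - ∑ i, (k i : ℝ) * b i = q / m := by
  classical
  have hterm : ∀ (l : ι → ℕ) (i : ι), (l i : ℝ) * b i ≤ ∑ i, (l i : ℝ) * b i := fun l i =>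
    Finset.single_le_sum (f := fun i => (l i : ℝ) * b i)
      (fun j _ => mul_nonneg (Nat.cast_nonneg _) (hb0 j)) (Finset.mem_univ i)
  by_cases hall : ∀ i, 0 < k i → 1 - b i ∈ R
  · have hq := mem_Rbar_of_multiplicities (m := 1) h1 one_pos k (fun i => 1 - b i) hall
      (by simpa using hS.le)
    exact ⟨_, hq, 1, one_pos, by simp⟩
  push Not at hall
  obtain ⟨i₀, hk₀, hi₀⟩ := hall
  have half_le : ∀ i, 0 < k i → 1 - b i ∉ R → 1 / 2 ≤ b i := by
    intro i hk hi
    obtain ⟨-, r, hr, m, hm, hbi⟩ := hb i hk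
    have hm2 : 2 ≤ m := by
      by_contra hlt
      obtain rfl : m = 1 := by omega
      exact hi (by simpa [hbi] using hr)
    have : r / m ≤ 1 / 2 :=
      div_le_div₀ zero_le_one (hsub hr).2 two_pos (by exact_mod_cast hm2)
    linarith
  have hb₀ := half_le i₀ hk₀ hi₀
  let l : ι → ℕ := Function.update k i₀ 0
  have hl₀ : l i₀ = 0 := Function.update_self ..
  have hl : ∀ i, i ≠ i₀ → l i = k i := fun i hi => Function.update_of_ne hi ..
  have hsplit : ∑ i, (k i : ℝ) * b i = k i₀ * b i₀ + ∑ i, (l i : ℝ) * b i := by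
    rw [← Finset.add_sum_erase _ _ (Finset.mem_univ i₀),
      ← Finset.add_sum_erase _ (fun i => (l i : ℝ) * b i) (Finset.mem_univ i₀), hl₀]
    simp only [Nat.cast_zero, zero_mul, zero_add, add_right_inj]
    exact Finset.sum_congr rfl fun i hi => by rw [hl i (Finset.ne_of_mem_erase hi)]
  have hl_nonneg : 0 ≤ ∑ i, (l i : ℝ) * b i :=
    Finset.sum_nonneg fun i _ => mul_nonneg (Nat.cast_nonneg _) (hb0 i)
  have hk₁ : k i₀ = 1 := by
    by_contra hne
    have : (2 : ℝ) ≤ k i₀ := by exact_mod_cast (by omega : 2 ≤ k i₀)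
    nlinarith
  rw [hk₁, Nat.cast_one, one_mul] at hsplit
  have hR : ∀ i, 0 < l i → 1 - b i ∈ R := by
    intro i hli
    by_contra hi
    have hne : i ≠ i₀ := by
      rintro rfl
      omega
    have hbi := half_le i (hl i hne ▸ hli) hi
    have : (1 : ℝ) ≤ l i := by exact_mod_cast hli
    nlinarith [hterm l i]
  obtain ⟨-, r, hr, m, hm, hbr⟩ := hb i₀ hk₀
  have hm' : (0 : ℝ) < m := by exact_mod_cast hm
  have heq : r - m * ∑ i, (l i : ℝ) * b i = m * (1 - ∑ i, (k i : ℝ) * b i) := by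
    rw [hsplit, hbr]
    field_simp
    ring
  have hq := mem_Rbar_of_multiplicities hr hm l (fun i => 1 - b i) hR (by
    simp only [sub_sub_cancel]
    rw [heq]
    exact mul_nonneg hm'.le (by linarith))
  simp only [sub_sub_cancel] at hq
  exact ⟨_, hq, m, hm, by rw [heq]; field_simp⟩

theorem stmt_10 (R : Set ℝ) (hsub : R ⊆ Set.Icc (0:ℝ) 1) (h1 : (1:ℝ) ∈ R)
    (ε : ℝ) (hε0 : 0 ≤ ε) (hε1 : ε ≤ 1)
    (n : ℕ) (hn : 0 < n) (s : ℕ)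
    (b : Fin (s+1) → ℝ) (hb : ∀ i, b i ∈ PhiEps R ε)
    (k : Fin (s+1) → ℕ)
    (d : ℝ) (hd : d = 1 - 1/(n:ℝ) + (∑ i, (k i : ℝ) * b i)/(n:ℝ))
    (hd1 : d < 1) :
    d ∈ PhiEps (Rbar R) ε := by
  have hn' : (1 : ℝ) ≤ n := by exact_mod_cast hn
  have hn0 : (0 : ℝ) < n := by linarith
  have hb0 : ∀ i, 0 ≤ b i := fun i => nonneg_of_mem_PhiEps hε1 (hb i)
  have hterm : ∀ i, (k i : ℝ) * b i ≤ ∑ i, (k i : ℝ) * b i := fun i =>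
    Finset.single_le_sum (f := fun i => (k i : ℝ) * b i)
      (fun j _ => mul_nonneg (Nat.cast_nonneg _) (hb0 j)) (Finset.mem_univ i)
  have hS0 : 0 ≤ ∑ i, (k i : ℝ) * b i :=
    Finset.sum_nonneg fun i _ => mul_nonneg (Nat.cast_nonneg _) (hb0 i)
  have hd' : d = 1 - (1 - ∑ i, (k i : ℝ) * b i) / n := by
    rw [hd]
    ring
  have hS1 : ∑ i, (k i : ℝ) * b i < 1 := by
    have : 0 < (1 - ∑ i, (k i : ℝ) * b i) / n := by linarith
    linarith [(div_pos_iff_of_pos_right hn0).1 this]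
  have hdS : ∑ i, (k i : ℝ) * b i ≤ d := by
    have := div_le_self (sub_nonneg.2 hS1.le) hn'
    linarith
  by_cases hall : ∀ i, 0 < k i → b i ∈ Phi R
  · obtain ⟨q, hq, m, hm, hqm⟩ :=
      exists_mem_Rbar_one_sub_sum_eq_div hsub h1 b k hb0 hall hS1
    refine Or.inl ⟨⟨hS0.trans hdS, hd1.le⟩, q, hq, m * n, Nat.mul_pos hm hn, ?_⟩
    rw [hd', hqm, Nat.cast_mul, div_div]
  · push Not at hall
    obtain ⟨i, hki, hbi⟩ := hall
    have hεb := ((hb i).resolve_left hbi).1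
    have hk1 : (1 : ℝ) ≤ k i := by exact_mod_cast hki
    have := le_mul_of_one_le_left (hb0 i) hk1
    exact Or.inr ⟨by linarith [hterm i], hd1.le⟩
end

section
/- Let N and r be positive integers and let c be a real number with 0 ≤ c < 1. Then there exists a positive integer q₀ such that for every integer q ≥ q₀, every real number b⁰ with 0 ≤ b⁰ ≤ c, and every integer m with |m/q − b⁰| < q^{−(1+1/r)}, one has ⌊(qN+1)·b⁰⌋ ≤ m·N. -/
theorem stmt_11 (N r : ℕ) (hN : 0 < N) (hr : 0 < r) (c : ℝ)
    (hc0 : 0 ≤ c) (hc1 : c < 1) :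
    ∃ q₀ : ℕ, 0 < q₀ ∧ ∀ q : ℕ, q₀ ≤ q →
      ∀ b : ℝ, 0 ≤ b → b ≤ c →
        ∀ m : ℤ, |(m : ℝ) / (q : ℝ) - b| < (q : ℝ) ^ (-(1 + 1/(r : ℝ))) →
          ⌊((q : ℝ) * (N : ℝ) + 1) * b⌋ ≤ m * (N : ℤ) := by
  have hNpos : (0 : ℝ) < N := by exact_mod_cast hN
  have hlim : Filter.Tendsto (fun q : ℕ => (q : ℝ) ^ (-(1 / (r : ℝ)))) Filter.atTop (nhds 0) :=
    (tendsto_rpow_neg_atTop (by positivity)).comp tendsto_natCast_atTop_atTop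
  obtain ⟨q₁, hq₁⟩ := Filter.eventually_atTop.1
    (hlim.eventually_lt_const (div_pos (sub_pos.2 hc1) hNpos))
  refine ⟨q₁ + 1, q₁.succ_pos, fun q hq b _ hbc m hm => ?_⟩
  have hqpos : (0 : ℝ) < q := by exact_mod_cast (Nat.succ_pos q₁).trans_le hq
  have hsmall : (q : ℝ) ^ (-(1 / (r : ℝ))) * N < 1 - c :=
    (lt_div_iff₀ hNpos).1 (hq₁ q (by omega))
  have hpow : (q : ℝ) * (q : ℝ) ^ (-(1 + 1 / (r : ℝ))) = (q : ℝ) ^ (-(1 / (r : ℝ))) := by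
    rw [← Real.rpow_one_add' hqpos.le (by simp [hr.ne'])]
    congr 1
    ring
  have hdist : (q : ℝ) * b - m < (q : ℝ) ^ (-(1 / (r : ℝ))) := by
    have h := mul_lt_mul_of_pos_left (neg_lt_of_abs_lt hm) hqpos
    have hdiv : (q : ℝ) * (m / q) = m := mul_div_cancel₀ _ hqpos.ne'
    linarith
  have hscaled := mul_lt_mul_of_pos_right hdist hNpos
  rw [← Int.lt_add_one_iff, Int.floor_lt]
  push_cast
  linarith
end

section
/- Let n be a positive integer, let r ≥ 0 be an integer, and let b, b⁺ ∈ ℝʳ be tuples with 0 ≤ b_i ≤ 1 and 0 ≤ b⁺_i ≤ 1 for all i, satisfying: (a) if b_i = 1 then b⁺_i = 1, and (b) if b_i < 1 then n·b⁺_i ≥ ⌊(n+1)·b_i⌋. Assume moreover that n·b⁺_i is an integer for each i. Then there exists ε > 0 such that for every tuple b' ∈ ℝʳ with 0 ≤ b'_i ≤ 1 and |b'_i − b_i| < ε for all i, one has: (a') if b'_i = 1 then b⁺_i = 1, and (b') if b'_i < 1 then n·b⁺_i ≥ ⌊(n+1)·b'_i⌋. (Openness of the existence of n-complements at the level of boundary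 multiplicities.) -/
open Filter Topology in
/-- The map `y ↦ ⌊c * y⌋` is upper semicontinuous. -/
theorem eventually_floor_mul_le (c x : ℝ) : ∀ᶠ y in 𝓝 x, ⌊c * y⌋ ≤ ⌊c * x⌋ := by
  have h : Tendsto (fun y : ℝ => c * y) (𝓝 x) (𝓝 (c * x)) :=
    (continuous_const_mul c).tendsto x
  filter_upwards [h.eventually_lt_const (Int.lt_floor_add_one (c * x))] with y hy
  exact Int.lt_add_one_iff.mp (Int.floor_lt.mpr (by exact_mod_cast hy))

open Filter Topology in
/-- The numerical complement conditions at a single multiplicity are open in the multiplicity. -/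
theorem eventually_complement_condition (n : ℕ) {x p : ℝ} (hx : x ≤ 1)
    (h_one : x = 1 → p = 1)
    (h_lt : x < 1 → (⌊((n : ℝ) + 1) * x⌋ : ℝ) ≤ (n : ℝ) * p) :
    ∀ᶠ y in 𝓝 x, (y = 1 → p = 1) ∧
      (y < 1 → (⌊((n : ℝ) + 1) * y⌋ : ℝ) ≤ (n : ℝ) * p) := by
  rcases hx.eq_or_lt with h | h
  · obtain rfl := h_one h
    refine Eventually.of_forall fun y => ⟨fun _ => rfl, fun hy => ?_⟩
    have hfloor : ⌊((n : ℝ) + 1) * y⌋ < (n : ℤ) + 1 := by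
      rw [Int.floor_lt]
      push_cast
      exact mul_lt_of_lt_one_right (by positivity) hy
    rw [mul_one]
    exact_mod_cast Int.lt_add_one_iff.mp hfloor
  · filter_upwards [eventually_lt_nhds h, eventually_floor_mul_le ((n : ℝ) + 1) x]
      with y hy hfloor
    exact ⟨fun h1 => absurd h1 hy.ne, fun _ => (Int.cast_le.mpr hfloor).trans (h_lt h)⟩

theorem stmt_12 (n : ℕ) (hn : 0 < n) (r : ℕ) (b bplus : Fin r → ℝ)
    (hb : ∀ i, 0 ≤ b i ∧ b i ≤ 1) (hbp : ∀ i, 0 ≤ bplus i ∧ bplus i ≤ 1)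
    (ha : ∀ i, b i = 1 → bplus i = 1)
    (hbnd : ∀ i, b i < 1 → (⌊((n : ℝ) + 1) * b i⌋ : ℝ) ≤ (n : ℝ) * bplus i)
    (hint : ∀ i, ∃ k : ℤ, (n : ℝ) * bplus i = (k : ℝ)) :
    ∃ ε > (0 : ℝ), ∀ b' : Fin r → ℝ,
      (∀ i, 0 ≤ b' i ∧ b' i ≤ 1 ∧ |b' i - b i| < ε) →
      ∀ i, (b' i = 1 → bplus i = 1) ∧
        (b' i < 1 → (⌊((n : ℝ) + 1) * b' i⌋ : ℝ) ≤ (n : ℝ) * bplus i) := by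
  obtain ⟨ε, hε, h⟩ := Metric.eventually_nhds_iff.mp <| Filter.eventually_all.mpr fun i =>
    ((continuous_apply i).tendsto b).eventually
      (eventually_complement_condition n (hb i).2 (ha i) (hbnd i))
  exact ⟨ε, hε, fun b' hb' => h ((dist_pi_lt_iff hε).mpr fun i => (hb' i).2.2)⟩
end

section
/- Let R ⊆ [0,1] be a set of real numbers, let ε be a real number with 0 ≤ ε ≤ 1, let n and μ be positive integers, let k be an integer with 1 ≤ k ≤ n, and let d ∈ Φ(R, ε) with d ≤ k/n. Then 1 − (k/n − d)/μ ∈ Φ(R(n), ε). (This is the multiplicity computation showing that the divisorial part of adjunction for a fibration takes multiplicities in Φ(R, ε) to multiplicities in Φ(R(n), ε).) -/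
/-- The set `R(n) = {x ∈ [0,1] : x = ρ + j/n, ρ ∈ R, j ∈ ℤ}`. -/
def Rn (R : Set ℝ) (n : ℕ) : Set ℝ :=
  {x | x ∈ Set.Icc (0:ℝ) 1 ∧ ∃ ρ ∈ R, ∃ j : ℤ, x = ρ + (j : ℝ) / (n : ℝ)}

theorem stmt_13 (R : Set ℝ) (hsub : R ⊆ Set.Icc (0:ℝ) 1)
    (ε : ℝ) (hε0 : 0 ≤ ε) (hε1 : ε ≤ 1)
    (n μ : ℕ) (hn : 0 < n) (hμ : 0 < μ)
    (k : ℤ) (hk1 : 1 ≤ k) (hkn : k ≤ (n : ℤ))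
    (d : ℝ) (hd : d ∈ PhiEps R ε) (hdk : d ≤ (k : ℝ) / (n : ℝ)) :
    1 - ((k : ℝ) / (n : ℝ) - d) / (μ : ℝ) ∈ PhiEps (Rn R n) ε := by
  have hn' : (0:ℝ) < n := by exact_mod_cast hn
  have hμ' : (1:ℝ) ≤ μ := by exact_mod_cast hμ
  have hkn' : (k:ℝ) / n ≤ 1 := by
    rw [div_le_one hn']
    exact_mod_cast hkn
  have hgap : 0 ≤ (k:ℝ) / n - d := sub_nonneg.mpr hdk
  have hdiv : ((k:ℝ) / n - d) / μ ≤ (k:ℝ) / n - d := div_le_self hgap hμ'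
  have hdiv0 : 0 ≤ ((k:ℝ) / n - d) / μ := by positivity
  rcases hd with ⟨⟨hd0, -⟩, r, hr, m, hm, rfl⟩ | ⟨hd, -⟩
  · left
    have hm' : (0:ℝ) < m := by exact_mod_cast hm
    have hnum : r + ((m * (k - n) : ℤ) : ℝ) / n = m * ((k:ℝ) / n - (1 - r / m)) := by
      push_cast
      field_simp
      ring
    refine ⟨⟨by linarith, by linarith⟩, r + ((m * (k - n) : ℤ) : ℝ) / n,
      ⟨⟨?_, ?_⟩, r, hr, _, rfl⟩, m * μ, Nat.mul_pos hm hμ, ?_⟩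
    · rw [hnum]
      positivity
    · calc r + ((m * (k - n) : ℤ) : ℝ) / n = m * ((k:ℝ) / n - (1 - r / m)) := hnum
        _ ≤ m * (r / m) := by gcongr; linarith
        _ = r := by field_simp
        _ ≤ 1 := (hsub hr).2
    · rw [hnum, Nat.cast_mul, mul_div_mul_left _ _ hm'.ne']
  · exact Or.inr ⟨by linarith, by linarith⟩
end

section
/- Let R := {0, 1/2, 2/3, 3/4, 5/6, 1}. If d ∈ Φ(R) and 24·d is not an integer, then d ≥ 13/18. -/
theorem stmt_14 (d : ℝ)
    (hd : d ∈ Phi {0, 1/2, 2/3, 3/4, 5/6, 1})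
    (hnotint : ¬ ∃ k : ℤ, 24 * d = (k : ℝ)) :
    13/18 ≤ d := by
  obtain ⟨-, r, hr, m, hm, rfl⟩ := hd
  simp only [Set.mem_insert_iff, Set.mem_singleton_iff] at hr
  have hm0 : (0 : ℝ) < m := by exact_mod_cast hm
  suffices h : r / m ≤ 5 / 18 by linarith
  by_contra! hlt
  rw [lt_div_iff₀ hm0] at hlt
  have hr1 : r ≤ 1 := by rcases hr with rfl | rfl | rfl | rfl | rfl | rfl <;> norm_num
  have hm4 : m < 4 := by
    have : (m : ℝ) < 4 := by linarith
    exact_mod_cast this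
  apply hnotint
  rcases hr with rfl | rfl | rfl | rfl | rfl | rfl <;> interval_cases m
  all_goals first
    | (refine absurd hlt ?_; norm_num; done)
    | (refine ⟨0, ?_⟩; norm_num; done)
    | (refine ⟨4, ?_⟩; norm_num; done)
    | (refine ⟨6, ?_⟩; norm_num; done)
    | (refine ⟨8, ?_⟩; norm_num; done)
    | (refine ⟨12, ?_⟩; norm_num; done)
    | (refine ⟨14, ?_⟩; norm_num; done)
    | (refine ⟨15, ?_⟩; norm_num; done)
    | (refine ⟨16, ?_⟩; norm_num)
end
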